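/- arXiv:1711.09656 — 2 statements merged into one kernel-verified Lean document; each statement's English description precedes it below -/
import Mathlib

section
/- Let G be a hereditary modular graph and let u, v be vertices of G. Then the subgraph of G induced on the interval I(u,v) is a hereditary modular graph. (Graph formulation of: intervals in quadric complexes are quadric.) -/
/-- A connected graph is modular if every triple of vertices has a median. -/
def Modular {W : Type*} (G : SimpleGraph W) : Prop :=
  G.Connected ∧ ∀ u v w : W, ∃ m : W,
    G.dist u m + G.dist m v = G.dist u v ∧
    G.dist u m + G.dist m w = G.dist u w ∧
    G.dist v m + G.dist m w = G.dist v w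

/-- A connected graph is hereditary modular if every connected isometric subgraph
of it is modular. -/
def HereditaryModular {V : Type*} (G : SimpleGraph V) : Prop :=
  G.Connected ∧ ∀ H : G.Subgraph, H.Connected →
    (∀ x y : H.verts, H.coe.dist x y = G.dist x.1 y.1) → Modular H.coe

/-- The interval `I(u,v)`: the set of vertices lying on geodesics from `u` to `v`. -/
def interval {V : Type*} (G : SimpleGraph V) (u v : V) : Set V :=
  {w | G.dist u w + G.dist w v = G.dist u v}

namespace SimpleGraph

variable {V W : Type*}

/-- Graph homomorphisms do not increase the distance between connected vertices. -/
theorem Reachable.dist_map_le {G : SimpleGraph V} {G' : SimpleGraph W} (f : G →g G') {x y : V}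
    (h : G.Reachable x y) : G'.dist (f x) (f y) ≤ G.dist x y := by
  obtain ⟨p, hp⟩ := h.exists_walk_length_eq_dist
  rw [← hp, ← Walk.length_map f p]
  exact dist_le _

theorem Iso.dist_eq {G : SimpleGraph V} {G' : SimpleGraph W} (e : G ≃g G')
    (hG : G.Connected) (x y : V) : G'.dist (e x) (e y) = G.dist x y := by
  refine le_antisymm ((hG.preconnected x y).dist_map_le e.toHom) ?_
  simpa using
    ((e.connected_iff.1 hG).preconnected (e x) (e y)).dist_map_le e.symm.toHom

/-- The isomorphism of a subgraph onto its image under an injective homomorphism. -/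
noncomputable def Subgraph.isoMap {G : SimpleGraph V} {G' : SimpleGraph W} (H : G.Subgraph)
    (f : G →g G') (hf : Function.Injective f) : H.coe ≃g (H.map f).coe where
  toEquiv := Equiv.Set.image f H.verts hf
  map_rel_iff' {a b} := by
    change (H.map f).Adj (f a) (f b) ↔ H.Adj a b
    rw [Subgraph.map_adj, Relation.map_apply]
    constructor
    · rintro ⟨c, d, h, hc, hd⟩
      rwa [← hf hc, ← hf hd]
    · exact fun h => ⟨a, b, h, rfl, rfl⟩

/-- Every vertex of a shortest walk lies in the interval between its ends. -/
theorem Walk.mem_interval_of_length_eq_dist {G : SimpleGraph V} (hG : G.Connected) {a b w : V}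
    (p : G.Walk a b) (hp : p.length = G.dist a b) (hw : w ∈ p.support) :
    w ∈ interval G a b := by
  obtain ⟨q, r, rfl⟩ := p.mem_support_iff_exists_append.1 hw
  rw [Walk.length_append] at hp
  have hq := G.dist_le q
  have hr := G.dist_le r
  have ht := hG.dist_triangle (u := a) (v := w) (w := b)
  change _ = _
  omega

/-- If a set contains the interval between two of its vertices, then it induces a subgraph
containing a walk between them that is shortest in the ambient graph. -/
theorem exists_induce_walk_of_interval_subset {G : SimpleGraph V} (hG : G.Connected) {s : Set V}
    {a b : V} (ha : a ∈ s) (hb : b ∈ s) (h : interval G a b ⊆ s) :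
    ∃ p : (G.induce s).Walk ⟨a, ha⟩ ⟨b, hb⟩, p.length = G.dist a b := by
  obtain ⟨p, hp⟩ := hG.exists_walk_length_eq_dist a b
  have hs : ∀ x ∈ p.support, x ∈ s := fun x hx =>
    h (p.mem_interval_of_length_eq_dist hG hp hx)
  refine ⟨p.induce s hs, ?_⟩
  rw [← hp, ← Walk.length_map (Embedding.induce s).toHom, Walk.map_induce]
  rfl

end SimpleGraph

theorem Modular.of_iso {V W : Type*} {G : SimpleGraph V} {G' : SimpleGraph W} (e : G ≃g G')
    (hG : Modular G) : Modular G' := by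
  refine ⟨e.connected_iff.1 hG.1, fun u v w => ?_⟩
  obtain ⟨m, hm⟩ := hG.2 (e.symm u) (e.symm v) (e.symm w)
  refine ⟨e m, ?_⟩
  simpa [← e.dist_eq hG.1] using hm

theorem HereditaryModular.modular {V : Type*} {G : SimpleGraph V} (hG : HereditaryModular G) :
    Modular G := by
  have hc : (⊤ : G.Subgraph).coe.Connected := SimpleGraph.Subgraph.topIso.connected_iff.2 hG.1
  refine (hG.2 ⊤ ⟨hc⟩ fun x y => ?_).of_iso SimpleGraph.Subgraph.topIso
  exact (SimpleGraph.Subgraph.topIso.dist_eq hc x y).symm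

theorem interval_subset_of_mem {V : Type*} {G : SimpleGraph V} (hG : G.Connected) {u v x p : V}
    (hx : x ∈ interval G u v) (hp : p ∈ interval G u x) : interval G p x ⊆ interval G u v := by
  intro w hw
  change _ = _ at hx hp hw
  change _ = _
  have h₁ := hG.dist_triangle (u := u) (v := p) (w := w)
  have h₂ := hG.dist_triangle (u := w) (v := x) (w := v)
  have h₃ := hG.dist_triangle (u := u) (v := w) (w := v)
  omega

/-- Intervals of modular graphs are isometric: a median of `u`, `x` and `y` lies on a geodesic
from `x` to `y` inside the interval between `u` and `v`. -/
theorem Modular.exists_interval_walk {V : Type*} {G : SimpleGraph V} (hG : Modular G) (u v : V)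
    (x y : interval G u v) :
    ∃ p : (G.induce (interval G u v)).Walk x y, p.length = G.dist x y := by
  obtain ⟨m, hx, hy, hxy⟩ := hG.2 u x y
  have hmx := interval_subset_of_mem hG.1 x.2 hx
  have hmy := interval_subset_of_mem hG.1 y.2 hy
  have hm : m ∈ interval G u v := hmx (by change _ = _; simp)
  obtain ⟨p, hp⟩ := G.exists_induce_walk_of_interval_subset hG.1 hm x.2 hmx
  obtain ⟨q, hq⟩ := G.exists_induce_walk_of_interval_subset hG.1 hm y.2 hmy
  refine ⟨p.reverse.append q, ?_⟩
  rw [SimpleGraph.Walk.length_append, SimpleGraph.Walk.length_reverse, hp, hq, ← hxy,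
    G.dist_comm (u := m)]

theorem Modular.connected_induce_interval {V : Type*} {G : SimpleGraph V} (hG : Modular G)
    (u v : V) : (G.induce (interval G u v)).Connected :=
  haveI : Nonempty (interval G u v) := ⟨u, by change _ = _; simp⟩
  ⟨fun x y => (hG.exists_interval_walk u v x y).choose.reachable⟩

theorem Modular.dist_induce_interval {V : Type*} {G : SimpleGraph V} (hG : Modular G) (u v : V)
    (x y : interval G u v) : (G.induce (interval G u v)).dist x y = G.dist x y := by
  refine le_antisymm ?_ ?_
  · obtain ⟨p, hp⟩ := hG.exists_interval_walk u v x y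
    exact hp ▸ SimpleGraph.dist_le p
  · exact ((hG.connected_induce_interval u v).preconnected x y).dist_map_le
      (SimpleGraph.Embedding.induce _).toHom

/-- An isometric connected induced subgraph of a hereditary modular graph is hereditary
modular. -/
theorem HereditaryModular.induce {V : Type*} {G : SimpleGraph V} (hG : HereditaryModular G)
    {s : Set V} (hs : (G.induce s).Connected)
    (hd : ∀ x y : s, (G.induce s).dist x y = G.dist x y) :
    HereditaryModular (G.induce s) := by
  refine ⟨hs, fun H hH hHd => ?_⟩
  let e := H.isoMap (SimpleGraph.Embedding.induce s).toHom Subtype.val_injective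
  refine (hG.2 _ ⟨e.connected_iff.1 hH.coe⟩ fun x y => ?_).of_iso e.symm
  obtain ⟨x, rfl⟩ := e.surjective x
  obtain ⟨y, rfl⟩ := e.surjective y
  rw [e.dist_eq hH.coe, hHd, hd]
  rfl

/-- Intervals in a hereditary modular graph induce hereditary modular graphs.
(Intervals in quadric complexes are quadric.) -/
theorem interval_hereditaryModular {V : Type*} (G : SimpleGraph V)
    (hG : HereditaryModular G) (u v : V) :
    HereditaryModular (G.induce (interval G u v)) :=
  hG.induce (hG.modular.connected_induce_interval u v) (hG.modular.dist_induce_interval u v)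
end

section
/- Let G be a connected K_4-free bridged graph, let u, v be vertices of G, and let w, x be two neighbours of v with d(u,w) = d(u,x) = d(u,v) − 1. Then w and x are adjacent. (Graph formulation of: in a 2-dimensional systolic complex, any two neighbours of v that are closer to u than v is are joined by an edge.) -/
/-- A graph is `K_4`-free if it has no four pairwise adjacent vertices. -/
def K4Free {V : Type*} (G : SimpleGraph V) : Prop :=
  ¬ ∃ a b c d : V, G.Adj a b ∧ G.Adj a c ∧ G.Adj a d ∧ G.Adj b c ∧ G.Adj b d ∧ G.Adj c d

/-- `f : ZMod n → V` is an isometric cycle of length `n` in `G`: an embedded cycle such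
that the distance in `G` between any two of its vertices equals their distance along the
cycle, which is `min (i - j).val ((j - i).val)`. -/
def IsIsometricCycle {V : Type*} (G : SimpleGraph V) (n : ℕ) (f : ZMod n → V) : Prop :=
  3 ≤ n ∧ Function.Injective f ∧
    (∀ i : ZMod n, G.Adj (f i) (f (i + 1))) ∧
    (∀ i j : ZMod n, G.dist (f i) (f j) = min (i - j).val (j - i).val)

/-- A graph is bridged if every isometric cycle in it has length 3. -/
def Bridged {V : Type*} (G : SimpleGraph V) : Prop :=
  ∀ (n : ℕ) (f : ZMod n → V), IsIsometricCycle G n f → n = 3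

/-- Neighbours of `v` closer to `u` than `v` are pairwise adjacent, for all pairs `u`, `v` at
distance `k`. -/
def IntervalClique {V : Type*} (G : SimpleGraph V) (k : ℕ) : Prop :=
  ∀ u v w x : V, G.dist u v = k → G.Adj v w → G.Adj v x → G.dist u w + 1 = k →
    G.dist u x + 1 = k → w ≠ x → G.Adj w x

/-- The edge `vw` is at distance `k` from `u` at both ends, and is in no triangle whose third
vertex is closer to `u`. -/
def IsTriangleObstruction {V : Type*} (G : SimpleGraph V) (k : ℕ) (u v w : V) : Prop :=
  G.dist u v = k ∧ G.dist u w = k ∧ G.Adj v w ∧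
    ∀ z, G.Adj v z → G.Adj w z → G.dist u z + 1 ≠ k

/-- The triangle condition for edges at distance `k` from a vertex. -/
def TriangleCondition {V : Type*} (G : SimpleGraph V) (k : ℕ) : Prop :=
  ∀ u v w : V, ¬ IsTriangleObstruction G k u v w

section

variable {V : Type*} {G : SimpleGraph V}

lemma dist_cycle_le (hconn : G.Connected) {n : ℕ} {f : ZMod n → V}
    (hadj : ∀ i, G.Adj (f i) (f (i + 1))) (i : ZMod n) (m : ℕ) :
    G.dist (f i) (f (i + m)) ≤ m := by
  induction m with
  | zero => simp
  | succ m ih =>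
    have h1 := hconn.dist_triangle (u := f i) (v := f (i + m)) (w := f (i + (m + 1 : ℕ)))
    have h2 : G.dist (f (i + m)) (f (i + (m + 1 : ℕ))) = 1 := by
      rw [SimpleGraph.dist_eq_one_iff_adj]
      have := hadj (i + m)
      rwa [add_assoc, ← Nat.cast_succ] at this
    omega

lemma isIsometricCycle_of_antipodal (hconn : G.Connected) {n : ℕ} (hn : 3 ≤ n) {f : ZMod n → V}
    (hadj : ∀ i, G.Adj (f i) (f (i + 1)))
    (hanti : ∀ i, G.dist (f i) (f (i + (n / 2 : ℕ))) = n / 2) : IsIsometricCycle G n f := by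
  have : NeZero n := ⟨by omega⟩
  have key : ∀ (i : ZMod n) (m : ℕ), m ≤ n / 2 → G.dist (f i) (f (i + m)) = m := by
    intro i m hm
    have h1 := dist_cycle_le hconn hadj i m
    have h2 := dist_cycle_le hconn hadj (i + m) (n / 2 - m)
    have h3 := hconn.dist_triangle (u := f i) (v := f (i + m)) (w := f (i + (n / 2 : ℕ)))
    rw [add_assoc, ← Nat.cast_add, Nat.add_sub_cancel' hm] at h2
    have := hanti i
    omega
  have hval : ∀ i j : ZMod n, (j - i).val ≤ n / 2 → G.dist (f i) (f j) = (j - i).val := by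
    intro i j h
    have := key i _ h
    rwa [ZMod.natCast_zmod_val, add_sub_cancel] at this
  have hdist : ∀ i j : ZMod n, G.dist (f i) (f j) = min (i - j).val (j - i).val := by
    intro i j
    by_cases hij : i = j
    · simp [hij]
    have hne : NeZero (j - i) := ⟨sub_ne_zero.mpr (Ne.symm hij)⟩
    have hneg : (i - j).val = n - (j - i).val := by
      rw [← neg_sub j i, ZMod.val_neg_of_ne_zero]
    have hlt := ZMod.val_lt (j - i)
    rcases le_or_gt (j - i).val (n / 2) with h | h
    · rw [hval i j h]; omega
    · rw [G.dist_comm, hval j i (by omega)]; omega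
  refine ⟨hn, fun i j h => ?_, hadj, hdist⟩
  have h0 := hdist i j
  rw [h, SimpleGraph.dist_self] at h0
  rcases min_eq_iff.mp h0.symm with h | h
  · exact sub_eq_zero.mp ((ZMod.val_eq_zero _).mp h.1)
  · exact (sub_eq_zero.mp ((ZMod.val_eq_zero _).mp h.1)).symm

lemma exists_cycle_of_walk {u : V} (W : G.Walk u u) {n : ℕ} (hn : 2 ≤ n) (hW : W.length = n) :
    ∃ f : ZMod n → V, (∀ i, G.Adj (f i) (f (i + 1))) ∧ ∀ m < n, f m = W.getVert m := by
  have : NeZero n := ⟨by omega⟩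
  have : Fact (1 < n) := ⟨hn⟩
  refine ⟨fun i => W.getVert i.val, fun i => ?_, fun m hm => by
    simp only [ZMod.val_cast_of_lt hm]⟩
  have hlt := ZMod.val_lt i
  have h := W.adj_getVert_succ (i := i.val) (by omega)
  rcases Nat.lt_or_ge (i.val + 1) n with h1 | h1
  · have : (i + 1).val = i.val + 1 := by
      rw [ZMod.val_add_of_lt (by rwa [ZMod.val_one]), ZMod.val_one]
    simp only [this]
    exact h
  · have h2 : i.val + 1 = n := by omega
    have : (i + 1).val = 0 := by
      rw [ZMod.val_add, ZMod.val_one, h2, Nat.mod_self]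
    simp only [this, SimpleGraph.Walk.getVert_zero]
    rwa [W.getVert_of_length_le (i := i.val + 1) (by omega)] at h

lemma dist_eq_two (hconn : G.Connected) {a b c : V} (hab : G.Adj a b) (hbc : G.Adj b c)
    (hne : a ≠ c) (hac : ¬ G.Adj a c) : G.dist a c = 2 := by
  have h := hconn.dist_triangle (u := a) (v := b) (w := c)
  have h1 := SimpleGraph.dist_eq_one_iff_adj.mpr hab
  have h2 := SimpleGraph.dist_eq_one_iff_adj.mpr hbc
  have h3 := hconn.pos_dist_of_ne hne
  have h4 : G.dist a c ≠ 1 := fun h => hac (SimpleGraph.dist_eq_one_iff_adj.mp h)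
  omega

lemma Bridged.not_induced_five_cycle (hconn : G.Connected) (hbr : Bridged G) {a b c d e : V}
    (hab : G.Adj a b) (hbc : G.Adj b c) (hcd : G.Adj c d) (hde : G.Adj d e) (hea : G.Adj e a)
    (hac : G.dist a c = 2) (hbd : G.dist b d = 2) (hce : G.dist c e = 2) (hda : G.dist d a = 2)
    (heb : G.dist e b = 2) : False := by
  let f : ZMod 5 → V := ![a, b, c, d, e]
  have h := hbr 5 f (isIsometricCycle_of_antipodal hconn (by norm_num)
    (fun i => by fin_cases i <;> assumption) (fun i => by fin_cases i <;> assumption))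
  omega

lemma intervalClique_one (hconn : G.Connected) : IntervalClique G 1 := by
  intro u v w x _ _ _ hw hx hne
  have h1 := (hconn.dist_eq_zero_iff (u := u) (v := w)).mp (by omega)
  have h2 := (hconn.dist_eq_zero_iff (u := u) (v := x)).mp (by omega)
  exact absurd (h1.symm.trans h2) hne

lemma triangleCondition_one : TriangleCondition G 1 := by
  rintro u v w ⟨hv, hw, -, h⟩
  exact h u (SimpleGraph.dist_eq_one_iff_adj.mp hv).symm
    (SimpleGraph.dist_eq_one_iff_adj.mp hw).symm (by simp)

/-- An even cycle built from a failure of `IntervalClique` is isometric as soon as antipodality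
can be transported along it. -/
lemma intervalClique_of_rotation (hconn : G.Connected) (hbr : Bridged G) {k : ℕ} (hk : 2 ≤ k)
    (hrot : ∀ u v w x y : V, G.dist u v = k → G.Adj v w → G.Adj v x → G.dist u w + 1 = k →
      G.dist u x + 1 = k → w ≠ x → ¬ G.Adj w x → G.Adj u y → G.dist y x + 2 = k →
      G.dist y w = k) : IntervalClique G k := by
  intro u v w x huv hvw hvx huw hux hwx
  by_contra hnadj
  obtain ⟨P, hP⟩ := hconn.exists_walk_length_eq_dist u x
  obtain ⟨Q, hQ⟩ := hconn.exists_walk_length_eq_dist w u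
  rw [G.dist_comm] at hQ
  let W : G.Walk u u := P.append (.cons hvx.symm (.cons hvw Q))
  obtain ⟨f, hadj, hf⟩ := exists_cycle_of_walk W (n := 2 * k) (by omega)
    (by simp [W]; omega)
  have hn : ((2 * k : ℕ) : ZMod (2 * k)) = 0 := ZMod.natCast_self _
  have hle := dist_cycle_le hconn hadj
  have inv : ∀ i : ℕ, G.dist (f i) (f (i + k : ℕ)) = k ∧
      f (i + k + 1 : ℕ) ≠ f (i + (k - 1) : ℕ) ∧
      ¬ G.Adj (f (i + k + 1 : ℕ)) (f (i + (k - 1) : ℕ)) := by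
    intro i
    induction i with
    | zero =>
      have h0 : f (0 : ℕ) = u := by rw [hf _ (by omega)]; simp
      have h1 : f (0 + (k - 1) : ℕ) = x := by
        rw [hf _ (by omega), SimpleGraph.Walk.getVert_append, if_neg (by omega)]
        rw [show 0 + (k - 1) - P.length = 0 by omega]
        simp
      have h2 : f (0 + k : ℕ) = v := by
        rw [hf _ (by omega), SimpleGraph.Walk.getVert_append, if_neg (by omega)]
        rw [show 0 + k - P.length = 1 by omega]
        simp
      have h3 : f (0 + k + 1 : ℕ) = w := by
        rw [hf _ (by omega), SimpleGraph.Walk.getVert_append, if_neg (by omega)]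
        rw [show 0 + k + 1 - P.length = 2 by omega]
        simp
      rw [h0, h1, h2, h3]
      exact ⟨huv, hwx, hnadj⟩
    | succ i ih =>
      obtain ⟨hd, hne, hna⟩ := ih
      have a1 : G.Adj (f (i + k : ℕ)) (f (i + k + 1 : ℕ)) := by
        have := hadj (i + k : ℕ); push_cast at this ⊢; exact this
      have a2 : G.Adj (f (i + (k - 1) : ℕ)) (f (i + k : ℕ)) := by
        have := hadj (i + (k - 1) : ℕ)
        rwa [← Nat.cast_succ, show (i + (k - 1)).succ = i + k by omega] at this
      have a3 : G.Adj (f i) (f (i + 1 : ℕ)) := by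
        have := hadj i; push_cast at this ⊢; exact this
      have l1 : G.dist (f (i + k + 1 : ℕ)) (f i) ≤ k - 1 := by
        have := hle (i + k + 1 : ℕ) (k - 1)
        rwa [← Nat.cast_add, show i + k + 1 + (k - 1) = i + 2 * k by omega, Nat.cast_add i, hn,
          add_zero] at this
      have l2 : G.dist (f (i + 1 : ℕ)) (f (i + (k - 1) : ℕ)) ≤ k - 2 := by
        have := hle (i + 1 : ℕ) (k - 2)
        rwa [← Nat.cast_add, show i + 1 + (k - 2) = i + (k - 1) by omega] at this
      have l3 : G.dist (f (i + k + 2 : ℕ)) (f i) ≤ k - 2 := by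
        have := hle (i + k + 2 : ℕ) (k - 2)
        rwa [← Nat.cast_add, show i + k + 2 + (k - 2) = i + 2 * k by omega, Nat.cast_add i, hn,
          add_zero] at this
      have e1 := SimpleGraph.dist_eq_one_iff_adj.mpr a1
      have e2 := SimpleGraph.dist_eq_one_iff_adj.mpr a2
      have e3 := SimpleGraph.dist_eq_one_iff_adj.mpr a3
      have t1 := hconn.dist_triangle (u := f i) (v := f (i + k + 1 : ℕ)) (w := f (i + k : ℕ))
      have t2 := hconn.dist_triangle (u := f i) (v := f (i + (k - 1) : ℕ)) (w := f (i + k : ℕ))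
      have t3 := hconn.dist_triangle (u := f i) (v := f (i + 1 : ℕ)) (w := f (i + (k - 1) : ℕ))
      rw [G.dist_comm] at l1 l3
      rw [G.dist_comm] at e1
      have hr := hrot (f i) (f (i + k : ℕ)) (f (i + k + 1 : ℕ)) (f (i + (k - 1) : ℕ))
        (f (i + 1 : ℕ)) hd a1 a2.symm (by omega) (by omega) hne hna a3 (by omega)
      rw [show i + 1 + k = i + k + 1 by omega, show i + 1 + (k - 1) = i + k by omega]
      refine ⟨hr, fun h => ?_, fun h => ?_⟩
      · rw [show i + k + 1 + 1 = i + k + 2 by omega] at h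
        rw [h] at l3
        omega
      · have t4 := hconn.dist_triangle (u := f i) (v := f (i + k + 2 : ℕ)) (w := f (i + k : ℕ))
        have := SimpleGraph.dist_eq_one_iff_adj.mpr h
        rw [show i + k + 1 + 1 = i + k + 2 by omega] at this
        omega
  have hne : NeZero (2 * k) := ⟨by omega⟩
  have := hbr (2 * k) f (isIsometricCycle_of_antipodal hconn (by omega) hadj fun i => by
    have := (inv i.val).1
    rw [Nat.cast_add, ZMod.natCast_zmod_val] at this
    rwa [show 2 * k / 2 = k by omega])
  omega

lemma intervalClique_two (hconn : G.Connected) (hbr : Bridged G) : IntervalClique G 2 := by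
  refine intervalClique_of_rotation hconn hbr le_rfl ?_
  intro u v w x y _ hvw hvx _ _ hwx hna _ hyx
  have h : y = x := (hconn.dist_eq_zero_iff).mp (by omega)
  subst h
  exact dist_eq_two hconn hvx.symm hvw hwx.symm (fun h => hna h.symm)

lemma adj_of_common_closer_neighbour (hconn : G.Connected) (hbr : Bridged G) {k : ℕ}
    (hIC : IntervalClique G k) (hTC : TriangleCondition G k) {u v w z x : V}
    (huv : G.dist u v = k + 1) (hvw : G.Adj v w) (hvx : G.Adj v x)
    (huw : G.dist u w = k) (huz : G.dist u z = k) (hux : G.dist u x = k)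
    (hwz : G.Adj w z) (hzx : G.Adj z x) (hwx : w ≠ x) : G.Adj w x := by
  by_contra hna
  have hIC2 := intervalClique_two hconn hbr
  obtain ⟨s, hws, hzs, hus⟩ : ∃ s, G.Adj w s ∧ G.Adj z s ∧ G.dist u s + 1 = k := by
    by_contra! h
    exact hTC u w z ⟨huw, huz, hwz, h⟩
  obtain ⟨t, hzt, hxt, hut⟩ : ∃ t, G.Adj z t ∧ G.Adj x t ∧ G.dist u t + 1 = k := by
    by_contra! h
    exact hTC u z x ⟨huz, hux, hzx, h⟩
  have far : ∀ y r, G.Adj v y → G.Adj y r → G.dist u r + 1 = k → G.dist v r = 2 := by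
    intro y r hvy hyr hur
    refine dist_eq_two hconn hvy hyr ?_ fun h => ?_
    · rintro rfl; omega
    · have h1 := hconn.dist_triangle (u := u) (v := r) (w := v)
      have h2 := SimpleGraph.dist_eq_one_iff_adj.mpr h.symm
      omega
  have hvs := far w s hvw hws hus
  have hvt := far x t hvx hxt hut
  have ew := SimpleGraph.dist_eq_one_iff_adj.mpr hvw
  have ex := SimpleGraph.dist_eq_one_iff_adj.mpr hvx
  have square : ∀ r, G.dist v r = 2 → G.Adj w r → G.Adj x r → False := fun r hr hwr hxr =>
    hna (hIC2 v r w x hr hwr.symm hxr.symm (by omega) (by omega) hwx)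
  have hst : s ≠ t := fun h => square s hvs hws (h ▸ hxt)
  have hadj := hIC u z s t huz hzs hzt hus hut hst
  have hwt : ¬ G.Adj w t := fun h => square t hvt h hxt
  have hxs : ¬ G.Adj x s := fun h => square s hvs hws h
  refine hbr.not_induced_five_cycle hconn hvw hws hadj hxt.symm hvx.symm hvs
    (dist_eq_two hconn hws hadj ?_ hwt)
    (dist_eq_two hconn hadj hxt.symm ?_ (fun h => hxs h.symm)) (by rwa [G.dist_comm])
    (dist_eq_two hconn hvx.symm hvw hwx.symm (fun h => hna h.symm))
  · rintro rfl; omega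
  · rintro rfl; omega

lemma intervalClique_succ (hconn : G.Connected) (hbr : Bridged G) {k : ℕ} (hk : 1 ≤ k)
    (hIC : IntervalClique G k) (hTC : TriangleCondition G k) : IntervalClique G (k + 1) := by
  refine intervalClique_of_rotation hconn hbr (by omega) ?_
  intro u v w x y huv hvw hvx huw hux hwx hna huy hyx
  have ev := SimpleGraph.dist_eq_one_iff_adj.mpr hvw
  have ex := SimpleGraph.dist_eq_one_iff_adj.mpr hvx.symm
  have ey := SimpleGraph.dist_eq_one_iff_adj.mpr huy
  have t1 := hconn.dist_triangle (u := u) (v := y) (w := v)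
  have t2 := hconn.dist_triangle (u := y) (v := x) (w := v)
  have t3 := hconn.dist_triangle (u := y) (v := v) (w := w)
  have t4 := hconn.dist_triangle (u := u) (v := y) (w := w)
  have hyv : G.dist y v = k := by omega
  by_contra hne
  rcases (show G.dist y w + 1 = k ∨ G.dist y w = k by omega) with h | h
  · exact hna (hIC y v w x hyv hvw hvx h (by omega) hwx)
  · obtain ⟨z, hvz, hwz, hyz⟩ : ∃ z, G.Adj v z ∧ G.Adj w z ∧ G.dist y z + 1 = k := by
      by_contra! h'
      exact hTC y v w ⟨hyv, h, hvw, h'⟩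
    have hzx : z ≠ x := fun h => hna (h ▸ hwz)
    have hadj := hIC y v z x hyv hvz hvx hyz (by omega) hzx
    have t5 := hconn.dist_triangle (u := u) (v := y) (w := z)
    have t6 := hconn.dist_triangle (u := u) (v := z) (w := v)
    have ez := SimpleGraph.dist_eq_one_iff_adj.mpr hvz.symm
    exact hna (adj_of_common_closer_neighbour hconn hbr hIC hTC huv hvw hvx (by omega)
      (by omega) (by omega) hwz hadj hwx)

lemma IsTriangleObstruction.rotate (hconn : G.Connected) {k : ℕ} (hk : 1 ≤ k)
    (hIC : IntervalClique G (k + 1)) (hTC : TriangleCondition G k) {u v w y : V}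
    (h : IsTriangleObstruction G (k + 1) u v w) (huy : G.Adj u y) (hyw : G.dist y w ≤ k) :
    IsTriangleObstruction G (k + 1) v u y := by
  obtain ⟨huv, huw, hvw, hno⟩ := h
  have ey := SimpleGraph.dist_eq_one_iff_adj.mpr huy
  have ev := SimpleGraph.dist_eq_one_iff_adj.mpr hvw.symm
  have t1 := hconn.dist_triangle (u := u) (v := y) (w := v)
  have t2 := hconn.dist_triangle (u := u) (v := y) (w := w)
  have t3 := hconn.dist_triangle (u := y) (v := w) (w := v)
  have hyv : G.dist y v = k + 1 := by
    by_contra hne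
    refine hTC y v w ⟨by omega, by omega, hvw, fun z hvz hwz hyz => hno z hvz hwz ?_⟩
    have t4 := hconn.dist_triangle (u := u) (v := y) (w := z)
    have t5 := hconn.dist_triangle (u := u) (v := z) (w := v)
    have ez := SimpleGraph.dist_eq_one_iff_adj.mpr hvz.symm
    omega
  refine ⟨by rwa [G.dist_comm], by rwa [G.dist_comm], huy, fun z huz hyz hvz => ?_⟩
  obtain ⟨P, hP⟩ := hconn.exists_walk_length_eq_dist v z
  cases P with
  | nil =>
    rw [SimpleGraph.Walk.length_nil] at hP
    omega
  | cons hvp P =>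
    rename_i p
    simp only [SimpleGraph.Walk.length_cons] at hP
    have hpz := SimpleGraph.dist_le P
    rw [G.dist_comm] at hpz
    have euz := SimpleGraph.dist_eq_one_iff_adj.mpr huz
    have eyz := SimpleGraph.dist_eq_one_iff_adj.mpr hyz
    have ep := SimpleGraph.dist_eq_one_iff_adj.mpr hvp.symm
    have s1 := hconn.dist_triangle (u := u) (v := z) (w := p)
    have s2 := hconn.dist_triangle (u := y) (v := z) (w := p)
    have s3 := hconn.dist_triangle (u := u) (v := p) (w := v)
    have s4 := hconn.dist_triangle (u := y) (v := p) (w := v)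
    have hpw : p ≠ w := by rintro rfl; omega
    have hadj := hIC y v p w hyv hvp hvw (by omega) (by omega) hpw
    exact hno p hvp hadj.symm (by omega)

lemma triangleCondition_succ (hconn : G.Connected) (hbr : Bridged G) {k : ℕ} (hk : 1 ≤ k)
    (hIC : IntervalClique G (k + 1)) (hTC : TriangleCondition G k) :
    TriangleCondition G (k + 1) := by
  intro u v w h
  obtain ⟨P, hP⟩ := hconn.exists_walk_length_eq_dist u v
  obtain ⟨Q, hQ⟩ := hconn.exists_walk_length_eq_dist w u
  rw [G.dist_comm] at hQ
  have huv := h.1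
  have huw := h.2.1
  let W : G.Walk u u := P.append (.cons h.2.2.1 Q)
  obtain ⟨f, hadj, hf⟩ := exists_cycle_of_walk W (n := 2 * (k + 1) + 1) (by omega)
    (by simp [W]; omega)
  have hn : ((2 * (k + 1) + 1 : ℕ) : ZMod (2 * (k + 1) + 1)) = 0 := ZMod.natCast_self _
  have hle := dist_cycle_le hconn hadj
  have step : ∀ i : ZMod (2 * (k + 1) + 1),
      IsTriangleObstruction G (k + 1) (f i) (f (i + (k + 1 : ℕ))) (f (i + (k + 2 : ℕ))) →
      IsTriangleObstruction G (k + 1) (f (i + (k + 2 : ℕ)))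
        (f (i + (k + 2 : ℕ) + (k + 1 : ℕ))) (f (i + (k + 2 : ℕ) + (k + 2 : ℕ))) := by
    intro i hi
    obtain ⟨hd1, hd2, ha, hno⟩ := hi
    have h1 : i + (k + 2 : ℕ) + (k + 1 : ℕ) = i := by
      rw [add_assoc, ← Nat.cast_add, show k + 2 + (k + 1) = 2 * (k + 1) + 1 by omega, hn, add_zero]
    have h2 : i + (k + 2 : ℕ) + (k + 2 : ℕ) = i + 1 := by
      rw [show k + 2 = k + 1 + 1 by omega, Nat.cast_succ (k + 1), ← add_assoc _ _ (1 : ZMod _),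
        ← Nat.cast_succ, h1]
    rw [h1, h2]
    refine IsTriangleObstruction.rotate hconn hk hIC hTC (w := f (i + (k + 1 : ℕ)))
      ⟨hd2, hd1, ha.symm, fun z hz1 hz2 => hno z hz2 hz1⟩ (hadj i) ?_
    have := hle (i + 1) k
    rwa [add_assoc, add_comm 1, ← Nat.cast_succ] at this
  have inv : ∀ i : ℕ, IsTriangleObstruction G (k + 1) (f i) (f (i + (k + 1 : ℕ)))
      (f (i + (k + 2 : ℕ))) := by
    intro i
    induction i with
    | zero =>
      have h0 : f (0 : ℕ) = u := by rw [hf _ (by omega)]; simp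
      have h1 : f (k + 1 : ℕ) = v := by
        rw [hf _ (by omega), SimpleGraph.Walk.getVert_append, if_neg (by omega)]
        rw [show k + 1 - P.length = 0 by omega]
        simp
      have h2 : f (k + 2 : ℕ) = w := by
        rw [hf _ (by omega), SimpleGraph.Walk.getVert_append, if_neg (by omega)]
        rw [show k + 2 - P.length = 1 by omega]
        simp
      rw [h0, Nat.cast_zero, zero_add, zero_add, h1, h2]
      exact h
    | succ i ih =>
      have h2 := step _ (step _ ih)
      have h3 : (i : ZMod (2 * (k + 1) + 1)) + (k + 2 : ℕ) + (k + 2 : ℕ) = (i + 1 : ℕ) := by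
        rw [← Nat.cast_add, ← Nat.cast_add,
          show i + (k + 2) + (k + 2) = i + 1 + (2 * (k + 1) + 1) by omega,
          Nat.cast_add (i + 1), hn, add_zero]
      rwa [h3] at h2
  have := hbr _ f (isIsometricCycle_of_antipodal hconn (by omega) hadj fun i => by
    have := (inv i.val).1
    rw [ZMod.natCast_zmod_val] at this
    rwa [show (2 * (k + 1) + 1) / 2 = k + 1 by omega])
  omega

lemma intervalClique_and_triangle (hconn : G.Connected) (hbr : Bridged G) {k : ℕ} (hk : 1 ≤ k) :
    IntervalClique G k ∧ TriangleCondition G k := by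
  induction k, hk using Nat.le_induction with
  | base => exact ⟨intervalClique_one hconn, triangleCondition_one⟩
  | succ k hk ih =>
    have h := intervalClique_succ hconn hbr hk ih.1 ih.2
    exact ⟨h, triangleCondition_succ hconn hbr hk h ih.2⟩

end

/-- In a connected `K₄`-free bridged graph, two neighbours of `v` that are closer to
`u` than `v` is are adjacent. -/
theorem closer_neighbours_adjacent {V : Type*} (G : SimpleGraph V)
    (hconn : G.Connected) (hK4 : K4Free G) (hbr : Bridged G) (u v w x : V)
    (hw : G.Adj v w) (hx : G.Adj v x) (hwx : w ≠ x)
    (hdw : G.dist u w + 1 = G.dist u v) (hdx : G.dist u x + 1 = G.dist u v) :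
    G.Adj w x := by
  have hpos : 1 ≤ G.dist u v := by omega
  exact (intervalClique_and_triangle hconn hbr hpos).1 u v w x rfl hw hx hdw hdx hwx
end
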